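/- arXiv:2104.11096 — 10 statements merged into one kernel-verified Lean document; each statement's English description precedes it below -/
import Mathlib

section
/- Let n ≥ 1, let F : ℝⁿ → ℝⁿ be monotone, let x* ∈ ℝⁿ satisfy F(x*) = 0, and let α, β > 0. Define the Lyapunov function V(x, r) = ½‖x − x*‖² + (β/(2α))‖r − x*‖². Then its derivative along the Heavy Anchor vector field (ẋ, ṙ) = (−F(x) − β(x − r), α(x − r)) satisfies, for all x, r ∈ ℝⁿ: ⟪x − x*, −F(x) − β(x − r)⟫ + (β/α)⟪r − x*, α(x − r)⟫ = −⟪x − x*, F(x) − F(x*)⟫ − β‖x − r‖² ≤ 0. -/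
open RealInnerProductSpace

/-- derivative of the Lyapunov function
`V(x,r) = ½‖x - x*‖² + (β/(2α))‖r - x*‖²` along the Heavy Anchor vector field
`(ẋ, ṙ) = (-F(x) - β(x - r), α(x - r))` equals
`-⟪x - x*, F x - F x*⟫ - β‖x - r‖²` and is nonpositive for monotone `F`. -/
theorem heavy_anchor_lyapunov_decrease (n : ℕ) (hn : 1 ≤ n)
    (F : EuclideanSpace ℝ (Fin n) → EuclideanSpace ℝ (Fin n))
    (hmono : ∀ x y, 0 ≤ ⟪F x - F y, x - y⟫)
    (xstar : EuclideanSpace ℝ (Fin n)) (hstar : F xstar = 0)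
    (α β : ℝ) (hα : 0 < α) (hβ : 0 < β) :
    ∀ x r : EuclideanSpace ℝ (Fin n),
      (⟪x - xstar, -F x - β • (x - r)⟫ + (β / α) * ⟪r - xstar, α • (x - r)⟫
          = -⟪x - xstar, F x - F xstar⟫ - β * ‖x - r‖ ^ 2)
        ∧ ⟪x - xstar, -F x - β • (x - r)⟫ + (β / α) * ⟪r - xstar, α • (x - r)⟫ ≤ 0 := by
  intro x r
  have key : ⟪x - xstar, -F x - β • (x - r)⟫ + (β / α) * ⟪r - xstar, α • (x - r)⟫
      = -⟪x - xstar, F x - F xstar⟫ - β * ‖x - r‖ ^ 2 := by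
    have hsq : ‖x - r‖ ^ 2 = ⟪x - xstar, x - r⟫ - ⟪r - xstar, x - r⟫ := by
      rw [← inner_sub_left, sub_sub_sub_cancel_right, real_inner_self_eq_norm_sq]
    rw [hsq, hstar, sub_zero, inner_sub_right, inner_neg_right, real_inner_smul_right,
      real_inner_smul_right]
    field_simp
    ring
  refine ⟨key, key.trans_le ?_⟩
  have hF := hmono x xstar
  rw [real_inner_comm] at hF
  have hnorm : 0 ≤ β * ‖x - r‖ ^ 2 := by positivity
  linarith
end

section
/- Let N, n ≥ 1, let F : ℝⁿ → ℝⁿ, let 𝐅 : ℝ^{Nn} → ℝⁿ satisfy 𝐅(𝟏_N ⊗ x) = F(x) for all x ∈ ℝⁿ, and let S : ℝⁿ → ℝ^{Nn} be a linear map (the transpose 𝓡ᵀ of the selection matrix) satisfying (𝟏_Nᵀ ⊗ I_n) ∘ S = I_n. Let L be a real symmetric N×N matrix with L𝟏_N = 0 and kernel exactly span{𝟏_N} (the Laplacian of a connected undirected graph), and set 𝐋 = L ⊗ I_n. Let α, β, c > 0. If (𝐱̄, 𝐫̄) ∈ ℝ^{Nn} × ℝ^{Nn} satisfies α(𝐱̄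 − 𝐫̄) = 0 and −S(𝐅(𝐱̄)) − β(𝐱̄ − 𝐫̄) − c𝐋𝐱̄ = 0, then there exists x* ∈ ℝⁿ with F(x*) = 0 such that 𝐱̄ = 𝐫̄ = 𝟏_N ⊗ x*. -/
/-- The entries of `L v` sum to zero when `L` is symmetric and annihilates the all-ones vector. -/
theorem sum_mulVec_eq_zero_of_isSymm {ι R : Type*} [Fintype ι] [CommSemiring R]
    {L : Matrix ι ι R} (hL : L.IsSymm) (hL1 : L.mulVec (fun _ => 1) = 0) (v : ι → R) :
    ∑ i, ∑ j, L i j * v j = 0 := by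
  rw [Finset.sum_comm]
  refine Finset.sum_eq_zero fun j _ => ?_
  have h : ∑ i, L j i = 0 := by simpa [Matrix.mulVec, dotProduct] using congrFun hL1 j
  rw [← Finset.sum_mul, Finset.sum_congr rfl fun i _ => hL.apply j i, h, zero_mul]


/-- any equilibrium of the distributed Heavy Anchor dynamics is a
consensus point `𝐱̄ = 𝐫̄ = 𝟏_N ⊗ x*` with `F(x*) = 0`.  Stacked vectors in
`ℝ^{Nn}` are represented as functions `Fin N → Fin n → ℝ`; `𝟏_N ⊗ x` is
`fun _ => x`; the map `(𝟏_Nᵀ ⊗ I_n)` is summing the blocks; `𝐋 = L ⊗ I_n`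
acts blockwise as `(𝐋 𝐱) i = ∑ j, L i j • 𝐱 j`. -/
theorem distributed_heavy_anchor_equilibrium (N n : ℕ) (hN : 1 ≤ N) (hn : 1 ≤ n)
    (F : (Fin n → ℝ) → (Fin n → ℝ))
    (Fbold : (Fin N → Fin n → ℝ) → (Fin n → ℝ))
    (hFbold : ∀ x : Fin n → ℝ, Fbold (fun _ => x) = F x)
    (S : (Fin n → ℝ) →ₗ[ℝ] (Fin N → Fin n → ℝ))
    (hS : ∀ z : Fin n → ℝ, ∑ i, S z i = z)
    (L : Matrix (Fin N) (Fin N) ℝ)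
    (hLsymm : L.IsSymm)
    (hL1 : L.mulVec (fun _ => 1) = 0)
    (hLker : ∀ v : Fin N → ℝ, L.mulVec v = 0 → ∃ c : ℝ, v = fun _ => c)
    (α β c : ℝ) (hα : 0 < α) (hβ : 0 < β) (hc : 0 < c)
    (xb rb : Fin N → Fin n → ℝ)
    (h1 : α • (xb - rb) = 0)
    (h2 : -(S (Fbold xb)) - β • (xb - rb) - c • (fun i => ∑ j, L i j • xb j) = 0) :
    ∃ xstar : Fin n → ℝ,
      F xstar = 0 ∧ xb = (fun _ => xstar) ∧ rb = (fun _ => xstar) := by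
  have hrx : rb = xb := ((sub_eq_zero.mp ((smul_eq_zero.mp h1).resolve_left hα.ne'))).symm
  subst hrx
  have hblock : ∀ i k, S (Fbold rb) i k + c * ∑ j, L i j * rb j k = 0 := by
    intro i k
    have h := congrFun (congrFun h2 i) k
    simp only [sub_self, smul_zero, sub_zero, Pi.sub_apply, Pi.neg_apply, Pi.smul_apply,
      Pi.zero_apply, Finset.sum_apply, smul_eq_mul] at h
    linarith
  have hz : Fbold rb = 0 := by
    funext k
    have hsum := Finset.sum_eq_zero fun i (_ : i ∈ Finset.univ) => hblock i k
    rw [Finset.sum_add_distrib, ← Finset.mul_sum,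
      sum_mulVec_eq_zero_of_isSymm hLsymm hL1 fun j => rb j k, mul_zero, add_zero,
      ← Finset.sum_apply, hS] at hsum
    exact hsum
  have hker : ∀ k, ∃ a : ℝ, (fun j => rb j k) = fun _ => a := by
    refine fun k => hLker _ (funext fun i => ?_)
    have h := hblock i k
    rw [hz, map_zero, Pi.zero_apply, Pi.zero_apply, zero_add] at h
    exact (mul_eq_zero.mp h).resolve_left hc.ne'
  choose xstar hxstar using hker
  have hcons : rb = fun _ => xstar := funext fun j => funext fun k => congrFun (hxstar k) j
  exact ⟨xstar, by rw [← hFbold, ← hcons, hz], hcons, hcons⟩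
end

section
/- Let H be a real Hilbert space, μ > 0, and let f : H → ℝ be a convex differentiable function whose gradient ∇f is (1/μ)-inverse Lipschitz, i.e. ‖x − y‖ ≤ (1/μ)‖∇f(x) − ∇f(y)‖ for all x, y ∈ H. Then ∇f is μ-strongly monotone: ⟪∇f(x) − ∇f(y), x − y⟫ ≥ μ‖x − y‖² for all x, y ∈ H. -/
open RealInnerProductSpace

section ConvexGradient

variable {H : Type*} [NormedAddCommGroup H] [InnerProductSpace ℝ H]

/-- A continuous, bounded below, midpoint-strongly convex function on a complete space
attains its minimum. -/
theorem exists_forall_le_of_midpoint_strongConvex [CompleteSpace H] {h : H → ℝ} {c : ℝ}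
    (hc : 0 < c) (hcont : Continuous h) (hbdd : BddBelow (Set.range h))
    (hmid : ∀ x y, c * ‖x - y‖ ^ 2 ≤ h x + h y - 2 * h ((1 / 2 : ℝ) • (x + y))) :
    ∃ x, ∀ y, h x ≤ h y := by
  set m := sInf (Set.range h)
  have hle : ∀ y, m ≤ h y := fun y => csInf_le hbdd ⟨y, rfl⟩
  have hex : ∀ n : ℕ, ∃ x, h x < m + 1 / ((n : ℝ) + 1) := fun n => by
    obtain ⟨_, ⟨x, rfl⟩, hx⟩ := exists_lt_of_csInf_lt (Set.range_nonempty h)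
      (show sInf (Set.range h) < m + 1 / ((n : ℝ) + 1) by
        have : 0 < 1 / ((n : ℝ) + 1) := by positivity
        linarith)
    exact ⟨x, hx⟩
  choose u hu using hex
  have hlim := tendsto_one_div_add_atTop_nhds_zero_nat (𝕜 := ℝ)
  have hcauchy : CauchySeq u := by
    refine cauchySeq_of_le_tendsto_0 (fun n : ℕ => √(2 / c * (1 / ((n : ℝ) + 1))))
      (fun i j N hi hj => ?_) ?_
    · rw [dist_eq_norm]
      refine Real.le_sqrt_of_sq_le ?_
      have h1 := hmid (u i) (u j)
      have h2 := hle ((1 / 2 : ℝ) • (u i + u j))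
      have h3 := Nat.one_div_le_one_div (α := ℝ) hi
      have h4 := Nat.one_div_le_one_div (α := ℝ) hj
      have h5 : c * ‖u i - u j‖ ^ 2 ≤ 2 * (1 / ((N : ℝ) + 1)) := by
        linarith [hu i, hu j]
      rw [div_mul_eq_mul_div, le_div_iff₀ hc]
      linarith
    · simpa using ((hlim.const_mul (2 / c)).sqrt)
  obtain ⟨x, hx⟩ := cauchySeq_tendsto_of_complete hcauchy
  refine ⟨x, fun y => (le_of_tendsto_of_tendsto ((hcont.tendsto x).comp hx)
    (hlim.const_add m) (.of_forall fun n => (hu n).le)).trans ?_⟩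
  simpa using hle y

variable [CompleteSpace H] {f : H → ℝ} {f' : H → H} {μ : ℝ}

/-- A convex function lies above its tangent hyperplanes. -/
theorem ConvexOn.add_inner_le_of_hasGradientAt {g x : H} (hconv : ConvexOn ℝ Set.univ f)
    (hgrad : HasGradientAt f g x) (y : H) : f x + ⟪g, y - x⟫ ≤ f y := by
  have hline : HasDerivAt (fun t : ℝ => f (AffineMap.lineMap x y t)) ⟪g, y - x⟫ 0 := by
    have h1 : HasFDerivAt f (InnerProductSpace.toDual ℝ H g) (AffineMap.lineMap x y (0 : ℝ)) := by
      simpa using hgrad.hasFDerivAt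
    simpa [Function.comp_def] using h1.comp_hasDerivAt (0 : ℝ) AffineMap.hasDerivAt_lineMap
  have hcl : ConvexOn ℝ Set.univ (fun t : ℝ => f (AffineMap.lineMap x y t)) :=
    hconv.comp_affineMap (AffineMap.lineMap x y)
  have := hcl.le_slope_of_hasDerivAt (Set.mem_univ 0) (Set.mem_univ 1) one_pos hline
  simp [slope_def_field] at this
  linarith

/-- The gradient of a convex function, perturbed by a positive multiple of the identity,
has a zero. -/
theorem ConvexOn.exists_grad_add_smul_eq_zero (hconv : ConvexOn ℝ Set.univ f)
    (hgrad : ∀ x, HasGradientAt f (f' x) x) {ε : ℝ} (hε : 0 < ε) :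
    ∃ x, f' x + ε • x = 0 := by
  have hcont : Continuous f := continuous_iff_continuousAt.2 fun x => (hgrad x).continuousAt
  obtain ⟨x, hx⟩ := exists_forall_le_of_midpoint_strongConvex (c := ε / 4)
    (h := fun x => f x + ε / 2 * ‖x‖ ^ 2) (by positivity) (by fun_prop)
    ⟨f 0 - ‖f' 0‖ ^ 2 / (2 * ε), by
      rintro _ ⟨y, rfl⟩
      have h1 := hconv.add_inner_le_of_hasGradientAt (hgrad 0) y
      have h2 := neg_le_of_abs_le (abs_real_inner_le_norm (f' 0) y)
      have h3 : ‖f' 0‖ ^ 2 / (2 * ε) + ε / 2 * ‖y‖ ^ 2 - ‖f' 0‖ * ‖y‖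
          = (‖f' 0‖ - ε * ‖y‖) ^ 2 / (2 * ε) := by field_simp; ring
      have h4 : 0 ≤ (‖f' 0‖ - ε * ‖y‖) ^ 2 / (2 * ε) := by positivity
      rw [sub_zero] at h1
      dsimp only
      linarith⟩
    (fun x y => by
      have h1 := hconv.2 (Set.mem_univ x) (Set.mem_univ y)
        (show (0 : ℝ) ≤ 1 / 2 by norm_num) (show (0 : ℝ) ≤ 1 / 2 by norm_num) (by norm_num)
      rw [← smul_add] at h1
      have h2 := parallelogram_law_with_norm ℝ x y
      have h3 : ‖(1 / 2 : ℝ) • (x + y)‖ ^ 2 = ‖x + y‖ ^ 2 / 4 := by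
        rw [norm_smul, mul_pow]; norm_num; ring
      simp only [smul_eq_mul] at h1
      rw [h3]
      have h4 : ε / 4 * ‖x - y‖ ^ 2
          = ε / 4 * (2 * (‖x‖ ^ 2 + ‖y‖ ^ 2) - ‖x + y‖ ^ 2) := by
        rw [← h2]; ring
      rw [h4]
      linarith)
  refine ⟨x, ?_⟩
  have hder := (hgrad x).hasFDerivAt.add
    ((hasStrictFDerivAt_norm_sq x).hasFDerivAt.const_mul (ε / 2))
  have hzero := IsLocalMin.hasFDerivAt_eq_zero (Filter.Eventually.of_forall hx) hder
  refine ext_inner_right ℝ fun v => ?_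
  have := DFunLike.congr_fun hzero v
  simp [inner_add_left, real_inner_smul_left] at this ⊢
  linarith

/-- The gradient of a convex function vanishes somewhere if it is inverse Lipschitz. -/
theorem ConvexOn.exists_grad_eq_zero (hconv : ConvexOn ℝ Set.univ f)
    (hgrad : ∀ x, HasGradientAt f (f' x) x) (hμ : 0 < μ)
    (hexp : ∀ x y, μ * ‖x - y‖ ≤ ‖f' x - f' y‖) : ∃ x, f' x = 0 := by
  have hcont : Continuous f := continuous_iff_continuousAt.2 fun x => (hgrad x).continuousAt
  have hlim := tendsto_one_div_add_atTop_nhds_zero_nat (𝕜 := ℝ)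
  have hsmall : ∀ n : ℕ, ∃ x, ‖f' x‖ ≤ ‖f' 0‖ * (1 / ((n : ℝ) + 1)) := fun n => by
    set δ : ℝ := 1 / ((n : ℝ) + 1)
    have hδ : 0 < δ := by positivity
    obtain ⟨x, hx⟩ := hconv.exists_grad_add_smul_eq_zero hgrad
      (show 0 < μ * δ / (1 + δ) by positivity)
    have h1 : ‖f' x‖ = μ * δ / (1 + δ) * ‖x‖ := by
      rw [eq_neg_of_add_eq_zero_left hx, norm_neg, norm_smul,
        Real.norm_of_nonneg (by positivity)]
    have h2 := (hexp x 0).trans (norm_sub_le _ _)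
    rw [sub_zero] at h2
    refine ⟨x, ?_⟩
    have h3 : (1 + δ) * ‖f' x‖ = δ * (μ * ‖x‖) := by rw [h1]; field_simp
    nlinarith
  choose u hu using hsmall
  have hbound : Filter.Tendsto (fun n : ℕ => ‖f' 0‖ * (1 / ((n : ℝ) + 1))) Filter.atTop
      (nhds 0) := by simpa using hlim.const_mul ‖f' 0‖
  have hgradlim : Filter.Tendsto (fun n => f' (u n)) Filter.atTop (nhds 0) :=
    squeeze_zero_norm hu hbound
  have hcauchy : CauchySeq u := by
    refine cauchySeq_of_le_tendsto_0 (fun n : ℕ => 2 / μ * (‖f' 0‖ * (1 / ((n : ℝ) + 1))))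
      (fun i j N hi hj => ?_) (by simpa using hbound.const_mul (2 / μ))
    rw [dist_eq_norm, div_mul_eq_mul_div, le_div_iff₀ hμ]
    have h1 := (hexp (u i) (u j)).trans (norm_sub_le _ _)
    have h2 := mul_le_mul_of_nonneg_left (Nat.one_div_le_one_div (α := ℝ) hi) (norm_nonneg (f' 0))
    have h3 := mul_le_mul_of_nonneg_left (Nat.one_div_le_one_div (α := ℝ) hj) (norm_nonneg (f' 0))
    linarith [hu i, hu j]
  obtain ⟨x, hx⟩ := cauchySeq_tendsto_of_complete hcauchy
  have hmin : ∀ y, f x ≤ f y := fun y => by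
    have h1 : Filter.Tendsto (fun n => f (u n) + ⟪f' (u n), y - u n⟫) Filter.atTop
        (nhds (f x + ⟪(0 : H), y - x⟫)) :=
      ((hcont.tendsto x).comp hx).add (hgradlim.inner (hx.const_sub y))
    have := le_of_tendsto h1 (.of_forall fun n =>
      hconv.add_inner_le_of_hasGradientAt (hgrad (u n)) y)
    simpa using this
  refine ⟨x, ?_⟩
  have := IsLocalMin.hasFDerivAt_eq_zero (Filter.Eventually.of_forall hmin) (hgrad x).hasFDerivAt
  simpa using this

/-- An inverse Lipschitz gradient of a convex function is surjective. -/
theorem ConvexOn.surjective_grad (hconv : ConvexOn ℝ Set.univ f)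
    (hgrad : ∀ x, HasGradientAt f (f' x) x) (hμ : 0 < μ)
    (hexp : ∀ x y, μ * ‖x - y‖ ≤ ‖f' x - f' y‖) : Function.Surjective f' := fun v => by
  have hconv' : ConvexOn ℝ Set.univ (fun x => f x - ⟪v, x⟫) :=
    hconv.sub ((innerSL ℝ v).toLinearMap.concaveOn convex_univ)
  have hgrad' : ∀ x, HasGradientAt (fun x => f x - ⟪v, x⟫) (f' x - v) x := fun x => by
    rw [hasGradientAt_iff_hasFDerivAt, map_sub]
    exact (hgrad x).hasFDerivAt.sub (InnerProductSpace.toDual ℝ H v).hasFDerivAt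
  obtain ⟨x, hx⟩ := hconv'.exists_grad_eq_zero hgrad' hμ (by simpa using hexp)
  exact ⟨x, sub_eq_zero.1 hx⟩

/-- The Bregman divergence of a convex function with inverse Lipschitz gradient is controlled
by the squared distance of the gradients. -/
theorem ConvexOn.bregman_le (hconv : ConvexOn ℝ Set.univ f)
    (hgrad : ∀ x, HasGradientAt f (f' x) x) (hμ : 0 < μ)
    (hexp : ∀ x y, μ * ‖x - y‖ ≤ ‖f' x - f' y‖) (x y : H) :
    μ * (f x - f y - ⟪f' y, x - y⟫) ≤ 1 / 2 * ‖f' x - f' y‖ ^ 2 := by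
  have hinner : ∀ w x y : H, μ * ⟪w, x - y⟫ ≤ ‖w‖ * ‖f' x - f' y‖ := fun w x y => by
    have h1 := mul_le_mul_of_nonneg_left (real_inner_le_norm w (x - y)) hμ.le
    have h2 := mul_le_mul_of_nonneg_left (hexp x y) (norm_nonneg w)
    linarith
  -- Halving the dual segment improves any constant towards `1 / 2`.
  have hiter : ∀ (n : ℕ) (x y : H), μ * (f x - f y - ⟪f' y, x - y⟫) ≤
      (1 / 2 * (1 + (1 / 2) ^ n)) * ‖f' x - f' y‖ ^ 2 := by
    intro n
    induction n with
    | zero =>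
      intro x y
      have h1 := hconv.add_inner_le_of_hasGradientAt (hgrad x) y
      have h2 := hinner (f' x - f' y) x y
      have h3 : f x - f y - ⟪f' y, x - y⟫ ≤ ⟪f' x - f' y, x - y⟫ := by
        rw [← neg_sub x y, inner_neg_right] at h1
        rw [inner_sub_left]
        linarith
      have h4 := mul_le_mul_of_nonneg_left h3 hμ.le
      norm_num
      linarith
    | succ n ih =>
      intro x y
      obtain ⟨m, hm⟩ := hconv.surjective_grad hgrad hμ hexp ((1 / 2 : ℝ) • (f' x + f' y))
      have hxm : f' x - f' m = (1 / 2 : ℝ) • (f' x - f' y) := by rw [hm]; module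
      have hmy : f' m - f' y = (1 / 2 : ℝ) • (f' x - f' y) := by rw [hm]; module
      have hnorm : ‖(1 / 2 : ℝ) • (f' x - f' y)‖ = 1 / 2 * ‖f' x - f' y‖ := by
        rw [norm_smul]; norm_num
      have h1 := ih x m
      have h2 := ih m y
      have h3 := hinner (f' m - f' y) x m
      rw [hxm, hnorm] at h1
      rw [hmy, hnorm] at h2
      rw [hxm, hmy, hnorm, ← hmy] at h3
      have h4 : f x - f y - ⟪f' y, x - y⟫ = (f x - f m - ⟪f' m, x - m⟫)
          + (f m - f y - ⟪f' y, m - y⟫) + ⟪f' m - f' y, x - m⟫ := by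
        simp only [inner_sub_left, inner_sub_right]; ring
      rw [h4, pow_succ]
      linarith
  have hlim : Filter.Tendsto
      (fun n : ℕ => (1 / 2 * (1 + (1 / 2 : ℝ) ^ n)) * ‖f' x - f' y‖ ^ 2) Filter.atTop
      (nhds ((1 / 2 * (1 + 0)) * ‖f' x - f' y‖ ^ 2)) :=
    (((tendsto_pow_atTop_nhds_zero_of_lt_one (by norm_num) (by norm_num)).const_add 1).const_mul
      _).mul_const _
  simpa using ge_of_tendsto' hlim fun n => hiter n x y

/-- The quadratic lower bound on the Bregman divergence, dual to `ConvexOn.bregman_le`. -/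
theorem ConvexOn.le_bregman (hconv : ConvexOn ℝ Set.univ f)
    (hgrad : ∀ x, HasGradientAt f (f' x) x) (hμ : 0 < μ)
    (hexp : ∀ x y, μ * ‖x - y‖ ≤ ‖f' x - f' y‖) (x y : H) :
    μ / 2 * ‖x - y‖ ^ 2 ≤ f x - f y - ⟪f' y, x - y⟫ := by
  obtain ⟨z, hz⟩ := hconv.surjective_grad hgrad hμ hexp (f' y + μ • (x - y))
  have h1 := hconv.add_inner_le_of_hasGradientAt (hgrad z) x
  have h2 := hconv.bregman_le hgrad hμ hexp y z
  have h3 : ‖f' y - f' z‖ ^ 2 = μ * (μ * ‖x - y‖ ^ 2) := by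
    rw [hz, sub_add_cancel_left, norm_neg, norm_smul, Real.norm_of_nonneg hμ.le]; ring
  have h4 : f y - f z - ⟪f' z, y - z⟫ ≤ 1 / 2 * (μ * ‖x - y‖ ^ 2) := by
    refine le_of_mul_le_mul_left ?_ hμ
    rw [h3] at h2
    linarith
  have h5 : ⟪f' z, x - z⟫ - ⟪f' z, y - z⟫ = ⟪f' y, x - y⟫ + μ * ‖x - y‖ ^ 2 := by
    rw [← inner_sub_right, sub_sub_sub_cancel_right, hz, inner_add_left, real_inner_smul_left,
      real_inner_self_eq_norm_sq]
  linarith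

end ConvexGradient

/-- Prop. `r→u`: if the gradient of a convex differentiable
function is `(1/μ)`-inverse Lipschitz, then it is `μ`-strongly monotone. -/
theorem grad_inverseLipschitz_imp_stronglyMonotone {H : Type*}
    [NormedAddCommGroup H] [InnerProductSpace ℝ H] [CompleteSpace H]
    (μ : ℝ) (hμ : 0 < μ) (f : H → ℝ) (f' : H → H)
    (hconv : ConvexOn ℝ Set.univ f)
    (hgrad : ∀ x, HasGradientAt f (f' x) x)
    (hinvLip : ∀ x y : H, ‖x - y‖ ≤ (1 / μ) * ‖f' x - f' y‖) :
    ∀ x y : H, μ * ‖x - y‖ ^ 2 ≤ ⟪f' x - f' y, x - y⟫ := by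
  have hexp : ∀ x y, μ * ‖x - y‖ ≤ ‖f' x - f' y‖ := fun x y => by
    rw [← le_inv_mul_iff₀ hμ, ← one_div]
    exact hinvLip x y
  intro x y
  have h1 := hconv.le_bregman hgrad hμ hexp x y
  have h2 := hconv.le_bregman hgrad hμ hexp y x
  rw [norm_sub_rev, ← neg_sub x y, inner_neg_right] at h2
  rw [inner_sub_left]
  linarith
end

section
/- Let H be a real inner product space, μ ≥ 0, R > 0, and λ > 0 with μR² ≤ λ and λμ < 1. Let T : H → H be μ-hypomonotone and R-inverse Lipschitz. Then R² + λ² − 2λμR² > 0, and for all u, v, x, y ∈ H with x = u + λT u and y = v + λT v one has ‖u − v‖ ≤ L_𝒥 ‖x − y‖, where L_𝒥 = √(R² / (R² + λ² − 2λμR²)). That is, the resolvent 𝒥_{λT} = (Id + λT)^{-1} is L_𝒥-Lipschitz. -/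
open RealInnerProductSpace

/-- Prop. resolvent (ii): for a `μ`-hypomonotone, `R`-inverse
Lipschitz operator `T` with `μR² ≤ λ` and `λμ < 1`, one has
`R² + λ² - 2λμR² > 0` and the resolvent `𝒥_{λT} = (Id + λT)⁻¹` is
`L_𝒥`-Lipschitz with `L_𝒥 = √(R²/(R² + λ² - 2λμR²))`. -/
theorem resolvent_lipschitz {H : Type*}
    [NormedAddCommGroup H] [InnerProductSpace ℝ H]
    (μ R lam : ℝ) (hμ : 0 ≤ μ) (hR : 0 < R) (hlam : 0 < lam)
    (hμR : μ * R ^ 2 ≤ lam) (hlamμ : lam * μ < 1)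
    (T : H → H)
    (hhypo : ∀ x y : H, -μ * ‖x - y‖ ^ 2 ≤ ⟪T x - T y, x - y⟫)
    (hinvLip : ∀ x y : H, ‖x - y‖ ≤ R * ‖T x - T y‖) :
    0 < R ^ 2 + lam ^ 2 - 2 * lam * μ * R ^ 2
      ∧ ∀ u v x y : H, x = u + lam • T u → y = v + lam • T v →
          ‖u - v‖ ≤ Real.sqrt (R ^ 2 / (R ^ 2 + lam ^ 2 - 2 * lam * μ * R ^ 2)) * ‖x - y‖ := by
  have hD : 0 < R ^ 2 + lam ^ 2 - 2 * lam * μ * R ^ 2 := by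
    have h₁ := mul_le_mul_of_nonneg_left hμR hlam.le
    have h₂ := mul_pos (pow_pos hR 2) (sub_pos.2 hlamμ)
    nlinarith
  refine ⟨hD, ?_⟩
  rintro u v x y rfl rfl
  have hnorm : ‖u + lam • T u - (v + lam • T v)‖ ^ 2 =
      ‖u - v‖ ^ 2 + 2 * lam * ⟪T u - T v, u - v⟫ + lam ^ 2 * ‖T u - T v‖ ^ 2 := by
    have : u + lam • T u - (v + lam • T v) = (u - v) + lam • (T u - T v) := by
      rw [smul_sub]; abel
    rw [this, norm_add_sq_real, inner_smul_right, norm_smul, mul_pow, Real.norm_eq_abs, sq_abs,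
      real_inner_comm]
    ring
  have hinner : -(2 * lam * μ * ‖u - v‖ ^ 2) ≤ 2 * lam * ⟪T u - T v, u - v⟫ := by
    linarith [mul_le_mul_of_nonneg_left (hhypo u v) (by positivity : 0 ≤ 2 * lam)]
  have hsq : ‖u - v‖ ^ 2 ≤ R ^ 2 * ‖T u - T v‖ ^ 2 := by
    rw [← mul_pow]
    exact pow_le_pow_left₀ (norm_nonneg _) (hinvLip u v) 2
  have hmain : ‖u - v‖ ^ 2 * (R ^ 2 + lam ^ 2 - 2 * lam * μ * R ^ 2) ≤
      R ^ 2 * ‖u + lam • T u - (v + lam • T v)‖ ^ 2 := by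
    rw [hnorm]
    linarith [mul_le_mul_of_nonneg_left hinner (sq_nonneg R),
      mul_le_mul_of_nonneg_left hsq (sq_nonneg lam)]
  refine (sq_le_sq₀ (norm_nonneg _) (by positivity)).1 ?_
  rw [mul_pow, Real.sq_sqrt (div_nonneg (sq_nonneg R) hD.le), div_mul_eq_mul_div, le_div_iff₀ hD]
  exact hmain
end

section
/- Let H be a real inner product space, μ ≥ 0, R > 0, and λ > 0 with μR² ≤ λ and λμ < 1. Let T : H → H be μ-hypomonotone and R-inverse Lipschitz. Define κ_𝒥 = R²(1 − μλ)/(R² + λ² − 2μλR²) if R ≥ λ, and κ_𝒥 = R²(1 + λ/R)/(R² + λ² + 2λR) if λ ≥ R. Then for all u, v, x, y ∈ H with x = u + λT u and y = v + λT v one has ⟪x − y, u − v⟫ ≤ κ_𝒥 ‖x − y‖². That is, the resolvent 𝒥_{λT} = (Id + λT)^{-1} satisfies ⟪x − y, 𝒥_{λT}x − 𝒥_{λT}y⟫ ≤ κ_𝒥‖x − y‖². -/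
open RealInnerProductSpace

/-- Prop. resolvent (iii): for a `μ`-hypomonotone, `R`-inverse
Lipschitz operator `T` with `μR² ≤ λ` and `λμ < 1`, the resolvent
`𝒥_{λT} = (Id + λT)⁻¹` satisfies `⟪x - y, 𝒥_{λT}x - 𝒥_{λT}y⟫ ≤ κ_𝒥 ‖x - y‖²`,
where `κ_𝒥 = R²(1 - μλ)/(R² + λ² - 2μλR²)` if `R ≥ λ` and
`κ_𝒥 = R²(1 + λ/R)/(R² + λ² + 2λR)` if `λ ≥ R`. -/
theorem resolvent_inner_bound {H : Type*}
    [NormedAddCommGroup H] [InnerProductSpace ℝ H]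
    (μ R lam : ℝ) (hμ : 0 ≤ μ) (hR : 0 < R) (hlam : 0 < lam)
    (hμR : μ * R ^ 2 ≤ lam) (hlamμ : lam * μ < 1)
    (T : H → H)
    (hhypo : ∀ x y : H, -μ * ‖x - y‖ ^ 2 ≤ ⟪T x - T y, x - y⟫)
    (hinvLip : ∀ x y : H, ‖x - y‖ ≤ R * ‖T x - T y‖) :
    ∀ u v x y : H, x = u + lam • T u → y = v + lam • T v →
      ⟪x - y, u - v⟫
        ≤ (if lam ≤ R then R ^ 2 * (1 - μ * lam) / (R ^ 2 + lam ^ 2 - 2 * μ * lam * R ^ 2)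
            else R ^ 2 * (1 + lam / R) / (R ^ 2 + lam ^ 2 + 2 * lam * R)) * ‖x - y‖ ^ 2 := by
  rintro u v x y rfl rfl
  have hc : -μ * ‖u - v‖ ^ 2 ≤ ⟪T u - T v, u - v⟫ := hhypo u v
  have hL : ‖u - v‖ ≤ R * ‖T u - T v‖ := hinvLip u v
  have hxy : u + lam • T u - (v + lam • T v) = (u - v) + lam • (T u - T v) := by module
  rw [hxy]
  generalize u - v = d at hc hL ⊢
  generalize T u - T v = t at hc hL ⊢
  have hinner : ⟪d + lam • t, d⟫ = ‖d‖ ^ 2 + lam * ⟪t, d⟫ := by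
    rw [inner_add_left, real_inner_smul_left, real_inner_self_eq_norm_sq]
  have hnorm : ‖d + lam • t‖ ^ 2 = ‖d‖ ^ 2 + 2 * lam * ⟪t, d⟫ + lam ^ 2 * ‖t‖ ^ 2 := by
    rw [norm_add_sq_real, real_inner_smul_right, norm_smul, mul_pow, Real.norm_eq_abs, sq_abs,
      real_inner_comm]
    ring
  have hsq : ‖d‖ ^ 2 ≤ R ^ 2 * ‖t‖ ^ 2 := by
    rw [← mul_pow]
    gcongr
  have hcoco : ⟪t, d⟫ ≤ R * ‖t‖ ^ 2 :=
    (real_inner_le_norm t d).trans <| by nlinarith [norm_nonneg t]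
  rw [hinner, hnorm]
  generalize ⟪t, d⟫ = c at *
  generalize ‖d‖ ^ 2 = a at *
  generalize ‖t‖ ^ 2 = b at *
  split_ifs with h
  · have hD : 0 < R ^ 2 + lam ^ 2 - 2 * μ * lam * R ^ 2 := by
      have h₁ : 0 < R ^ 2 * (1 - lam * μ) := mul_pos (by positivity) (by linarith)
      have h₂ : 0 ≤ lam * (lam - μ * R ^ 2) := mul_nonneg hlam.le (by linarith)
      linarith
    rw [div_mul_eq_mul_div, le_div_iff₀ hD]
    have h₁ : 0 ≤ lam * (R ^ 2 - lam ^ 2) * (c + μ * a) :=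
      mul_nonneg (mul_nonneg hlam.le (by nlinarith)) (by linarith)
    have h₂ : 0 ≤ lam ^ 2 * (1 - lam * μ) * (R ^ 2 * b - a) :=
      mul_nonneg (mul_nonneg (by positivity) (by linarith)) (by linarith)
    linarith
  · have hκ : R ^ 2 * (1 + lam / R) / (R ^ 2 + lam ^ 2 + 2 * lam * R) = R / (R + lam) := by
      have hden : R ^ 2 + lam ^ 2 + 2 * lam * R = (R + lam) ^ 2 := by ring
      rw [hden]
      field_simp
    rw [hκ, div_mul_eq_mul_div, le_div_iff₀ (by positivity)]
    have h₁ : 0 ≤ lam * (lam - R) * (R * b - c) :=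
      mul_nonneg (mul_nonneg hlam.le (by linarith)) (by linarith)
    have h₂ : 0 ≤ lam * (R ^ 2 * b - a) := mul_nonneg hlam.le (by linarith)
    linarith
end

section
/- Let n ≥ 1, R > 0, and let T : ℝⁿ → ℝⁿ be continuously differentiable with Jacobian JT(x) at each x. If JT(x)ᵀ JT(x) ⪰ (1/R²) I for every x ∈ ℝⁿ (equivalently ‖JT(x) v‖ ≥ (1/R)‖v‖ for all x, v), then T is R-inverse Lipschitz: ‖x − y‖ ≤ R‖T x − T y‖ for all x, y ∈ ℝⁿ. -/
open Set Filter Topology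

section UniformSection

variable {X Y : Type*} [TopologicalSpace X] [PseudoMetricSpace Y] {T : X → Y}

/-- Around every point, a local homeomorphism has continuous sections through all nearby points,
defined on balls of a uniform radius. -/
lemma IsLocalHomeomorph.exists_uniform_section_nhds (hT : IsLocalHomeomorph T) (z : X) :
    ∃ δ > 0, ∀ᶠ z' in 𝓝 z, ∃ g : Y → X, ContinuousOn g (Metric.ball (T z') δ) ∧
      g (T z') = z' ∧ ∀ w ∈ Metric.ball (T z') δ, T (g w) = w := by
  obtain ⟨e, hz, rfl⟩ := hT z
  obtain ⟨ε, hε, hball⟩ := Metric.isOpen_iff.1 e.open_target _ (e.map_source hz)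
  refine ⟨ε / 2, half_pos hε, ?_⟩
  filter_upwards [e.open_source.mem_nhds hz,
    (e.continuousAt hz).preimage_mem_nhds (Metric.ball_mem_nhds _ (half_pos hε))] with z' hz' hd
  have hsub : Metric.ball (e z') (ε / 2) ⊆ e.target :=
    (Metric.ball_subset_ball' (by have := Metric.mem_ball.1 hd; linarith)).trans hball
  exact ⟨e.symm, e.continuousOn_symm.mono hsub, e.left_inv hz', fun w hw ↦ e.right_inv (hsub hw)⟩

/-- On a compact set, a local homeomorphism has continuous sections through all points, defined on
balls of a uniform radius. -/
lemma IsLocalHomeomorph.exists_uniform_section (hT : IsLocalHomeomorph T) {K : Set X}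
    (hK : IsCompact K) :
    ∃ δ > 0, ∀ z ∈ K, ∃ g : Y → X, ContinuousOn g (Metric.ball (T z) δ) ∧
      g (T z) = z ∧ ∀ w ∈ Metric.ball (T z) δ, T (g w) = w := by
  refine hK.induction_on (p := fun K ↦ ∃ δ > 0, ∀ z ∈ K, ∃ g : Y → X,
    ContinuousOn g (Metric.ball (T z) δ) ∧ g (T z) = z ∧
      ∀ w ∈ Metric.ball (T z) δ, T (g w) = w) ⟨1, one_pos, by simp⟩ ?_ ?_ ?_
  · rintro s t hst ⟨δ, hδ, h⟩
    exact ⟨δ, hδ, fun z hz ↦ h z (hst hz)⟩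
  · rintro s t ⟨δ₁, hδ₁, h₁⟩ ⟨δ₂, hδ₂, h₂⟩
    refine ⟨min δ₁ δ₂, lt_min hδ₁ hδ₂, ?_⟩
    rintro z (hz | hz)
    · obtain ⟨g, hg, hgz, hgT⟩ := h₁ z hz
      have hsub := Metric.ball_subset_ball (x := T z) (min_le_left δ₁ δ₂)
      exact ⟨g, hg.mono hsub, hgz, fun w hw ↦ hgT w (hsub hw)⟩
    · obtain ⟨g, hg, hgz, hgT⟩ := h₂ z hz
      have hsub := Metric.ball_subset_ball (x := T z) (min_le_right δ₁ δ₂)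
      exact ⟨g, hg.mono hsub, hgz, fun w hw ↦ hgT w (hsub hw)⟩
  · intro z _
    obtain ⟨δ, hδ, h⟩ := hT.exists_uniform_section_nhds z
    exact ⟨_, mem_nhdsWithin_of_mem_nhds h, δ, hδ, fun z' hz' ↦ hz'⟩

end UniformSection

section InverseLipschitz

variable {E F : Type*} [NormedAddCommGroup E] [NormedSpace ℝ E]
  [NormedAddCommGroup F] [NormedSpace ℝ F]
  {T : E → F} {J : E → E ≃L[ℝ] F} {R : ℝ}

/-- Lifts of a segment through a map with inverse derivative bounded by `R` are Lipschitz. -/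
lemma norm_lift_sub_le (hderiv : ∀ x, HasFDerivAt T (J x : E →L[ℝ] F) x)
    (hbound : ∀ x v, ‖v‖ ≤ R * ‖J x v‖) {p v : F} {γ : ℝ → E} {s : ℝ}
    (hγ : ContinuousOn γ (Icc 0 s)) (hlift : ∀ t ∈ Icc 0 s, T (γ t) = p + t • v) :
    ∀ t ∈ Icc 0 s, ‖γ t - γ 0‖ ≤ R * ‖v‖ * t := by
  have hd : ∀ t ∈ Icc 0 s, HasDerivWithinAt γ ((J (γ t)).symm v) (Icc 0 s) t := by
    intro t ht
    have hline : HasDerivWithinAt (fun t : ℝ ↦ p + t • v) v (Icc 0 s) t := by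
      simpa using (((hasDerivAt_id t).smul_const v).const_add p).hasDerivWithinAt
    have h := HasFDerivWithinAt.of_comp_of_leftInverse (g := γ) (f := T) (t := univ)
      (f'symm := ((J (γ t)).symm : F →L[ℝ] E))
      (by simpa using (hγ t ht).tendsto) (hderiv (γ t)).hasFDerivWithinAt hline.hasFDerivWithinAt
      (eventually_mem_nhdsWithin.mono fun u hu ↦ hlift u hu)
      (J (γ t)).symm_apply_apply ht
    simpa using h.hasDerivWithinAt
  have := norm_image_sub_le_of_norm_deriv_le_segment' hd (C := R * ‖v‖)
    fun t _ ↦ by simpa using hbound (γ t) ((J (γ t)).symm v)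
  simpa using this

/-- Segments lift through a local homeomorphism whose inverse derivative is bounded by `R`. -/
lemma exists_lift_segment [ProperSpace E] (hT : IsLocalHomeomorph T)
    (hderiv : ∀ x, HasFDerivAt T (J x : E →L[ℝ] F) x)
    (hR : 0 ≤ R) (hbound : ∀ x v, ‖v‖ ≤ R * ‖J x v‖) (x : E) (v : F) :
    ∃ γ : ℝ → E, ContinuousOn γ (Icc 0 1) ∧ γ 0 = x ∧
      ∀ t ∈ Icc (0 : ℝ) 1, T (γ t) = T x + t • v := by
  obtain ⟨δ, hδ, hsec⟩ := hT.exists_uniform_section (isCompact_closedBall x (R * ‖v‖))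
  obtain ⟨η, hη, hηv⟩ : ∃ η > 0, η * ‖v‖ < δ := by
    refine ⟨δ / (‖v‖ + 1), by positivity, ?_⟩
    rw [div_mul_eq_mul_div, div_lt_iff₀ (by positivity)]
    nlinarith
  have key : ∀ n : ℕ, ∃ γ : ℝ → E, ContinuousOn γ (Icc 0 (min (n * η) 1)) ∧ γ 0 = x ∧
      ∀ t ∈ Icc 0 (min (n * η) 1), T (γ t) = T x + t • v := by
    intro n
    induction n with
    | zero =>
      refine ⟨fun _ ↦ x, continuousOn_const, rfl, fun t ht ↦ ?_⟩
      have : t = 0 := by simpa using ht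
      simp [this]
    | succ n ih =>
      obtain ⟨γ, hγ, hγ0, hlift⟩ := ih
      set s := min (n * η) 1 with hs
      have hs0 : 0 ≤ s := by positivity
      have hs1 : s ≤ 1 := min_le_right _ _
      have hsmem : s ∈ Icc 0 s := ⟨hs0, le_rfl⟩
      have hball : γ s ∈ Metric.closedBall x (R * ‖v‖) := by
        rw [mem_closedBall_iff_norm, ← hγ0]
        exact (norm_lift_sub_le hderiv hbound hγ hlift s hsmem).trans
          (mul_le_of_le_one_right (by positivity) hs1)
      obtain ⟨g, hg, hgs, hgT⟩ := hsec _ hball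
      have hnext : min ((n + 1 : ℕ) * η) 1 ≤ s + η := by
        rw [hs, ← min_add_add_right]
        push_cast
        exact min_le_min (by linarith) (by linarith)
      have hmaps : ∀ t, s ≤ t → t ≤ min ((n + 1 : ℕ) * η) 1 →
          T x + t • v ∈ Metric.ball (T (γ s)) δ := by
        intro t hst ht
        rw [hlift s hsmem, mem_ball_iff_norm, add_sub_add_left_eq_sub, ← sub_smul, norm_smul,
          Real.norm_of_nonneg (by linarith)]
        exact (mul_le_mul_of_nonneg_right (by linarith) (norm_nonneg v)).trans_lt hηv
      refine ⟨fun t ↦ if t ≤ s then γ t else g (T x + t • v), ?_, by simp [hs0, hγ0], ?_⟩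
      · refine ContinuousOn.if ?_ (hγ.mono ?_) (hg.comp (by fun_prop) ?_)
        · rintro t ⟨-, ht⟩
          have hts : t = s := frontier_le_subset_eq continuous_id continuous_const ht
          rw [hts, ← hlift s hsmem, hgs]
        · rintro t ⟨ht, ht'⟩
          exact ⟨ht.1, (closure_le_eq continuous_id continuous_const).subset ht'⟩
        · rintro t ⟨ht, ht'⟩
          simp_rw [not_le] at ht'
          exact hmaps t (closure_lt_subset_le continuous_const continuous_id ht') ht.2
      · intro t ht
        dsimp only
        split_ifs with hts
        · exact hlift t ⟨ht.1, hts⟩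
        · exact hgT _ (hmaps t (not_le.1 hts).le ht.2)
  obtain ⟨n, hn⟩ := exists_nat_ge (1 / η)
  have := key n
  rwa [min_eq_right ((div_le_iff₀ hη).1 hn)] at this

/-- A `C¹` map whose derivatives are invertible with inverses bounded by `R` is `R`-inverse
Lipschitz. -/
theorem norm_sub_le_of_norm_le_fderiv [ProperSpace E]
    (hderiv : ∀ x, HasFDerivAt T (J x : E →L[ℝ] F) x)
    (hcont : Continuous fun x ↦ (J x : E →L[ℝ] F))
    (hR : 0 ≤ R) (hbound : ∀ x v, ‖v‖ ≤ R * ‖J x v‖) (x y : E) :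
    ‖x - y‖ ≤ R * ‖T x - T y‖ := by
  have hT : IsLocalHomeomorph T := by
    refine IsLocalHomeomorph.mk T fun z ↦ ?_
    have hs : HasStrictFDerivAt T (J z : E →L[ℝ] F) z :=
      hasStrictFDerivAt_of_hasFDerivAt_of_continuousAt (.of_forall hderiv) hcont.continuousAt
    exact ⟨hs.toOpenPartialHomeomorph T, hs.mem_toOpenPartialHomeomorph_source, fun _ _ ↦ rfl⟩
  have hsep : IsSeparatedMap T := T2Space.isSeparatedMap T
  let c : unitInterval → E := fun s ↦ x + (s : ℝ) • (y - x)
  have hc : Continuous c := by fun_prop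
  choose Γ hΓ hΓ0 hlift using fun s ↦
    exists_lift_segment hT hderiv hR hbound x (T (c s) - T x)
  let f : C(unitInterval × unitInterval, F) :=
    ⟨fun ts ↦ T x + (ts.1 : ℝ) • (T (c ts.2) - T x), by
      have := hT.continuous
      fun_prop⟩
  have hΓcont : Continuous fun ts : unitInterval × unitInterval ↦ Γ ts.2 ts.1 := by
    refine hT.continuous_lift hsep f ?_ ?_ fun s ↦ ?_
    · ext ts
      exact hlift ts.2 ts.1 ts.1.2
    · simpa [hΓ0] using continuous_const
    · exact (hΓ s).comp_continuous continuous_subtype_val fun t ↦ t.2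
  have hend : (fun s ↦ Γ s (1 : unitInterval)) = c := by
    refine hsep.eq_of_comp_eq hT.isLocallyInjective
      (hΓcont.comp (Continuous.prodMk_right (1 : unitInterval))) hc ?_ 0 ?_
    · ext s
      simpa using hlift s 1 (by simp)
    · have := norm_lift_sub_le hderiv hbound (hΓ 0) (hlift 0) 1 (by simp)
      simpa [c, hΓ0, sub_eq_zero] using this
  have hy : Γ 1 1 = y := by simpa [c] using congrFun hend 1
  have := norm_lift_sub_le hderiv hbound (hΓ 1) (hlift 1) 1 (by simp)
  rw [hy, hΓ0] at this
  rw [norm_sub_rev x, norm_sub_rev (T x)]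
  simpa [c] using this

end InverseLipschitz

/-- Prop. sufficient condition (4): a continuously differentiable
operator `T : ℝⁿ → ℝⁿ` whose Jacobian satisfies `JT(x)ᵀJT(x) ⪰ (1/R²)I`
(equivalently `‖JT(x)v‖ ≥ (1/R)‖v‖` for all `x, v`) is `R`-inverse Lipschitz. -/
theorem jacobian_lower_bound_imp_inverseLipschitz (n : ℕ) (hn : 1 ≤ n)
    (R : ℝ) (hR : 0 < R)
    (T : EuclideanSpace ℝ (Fin n) → EuclideanSpace ℝ (Fin n))
    (J : EuclideanSpace ℝ (Fin n) →
      (EuclideanSpace ℝ (Fin n) →L[ℝ] EuclideanSpace ℝ (Fin n)))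
    (hderiv : ∀ x, HasFDerivAt T (J x) x)
    (hcont : Continuous J)
    (hbound : ∀ x v : EuclideanSpace ℝ (Fin n), (1 / R) * ‖v‖ ≤ ‖J x v‖) :
    ∀ x y : EuclideanSpace ℝ (Fin n), ‖x - y‖ ≤ R * ‖T x - T y‖ := by
  have hbound' : ∀ x v, ‖v‖ ≤ R * ‖J x v‖ := fun x v ↦ by
    have := hbound x v
    rwa [one_div, inv_mul_le_iff₀ hR] at this
  have hinj : ∀ x, Function.Injective (J x).toLinearMap := fun x ↦
    (injective_iff_map_eq_zero _).2 fun v hv ↦ by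
      have h0 : J x v = 0 := hv
      simpa [h0] using hbound' x v
  let J' : EuclideanSpace ℝ (Fin n) → EuclideanSpace ℝ (Fin n) ≃L[ℝ] EuclideanSpace ℝ (Fin n) :=
    fun x ↦ (LinearEquiv.ofInjectiveEndo _ (hinj x)).toContinuousLinearEquiv
  have hJ' : ∀ x, (J' x : EuclideanSpace ℝ (Fin n) →L[ℝ] EuclideanSpace ℝ (Fin n)) = J x :=
    fun x ↦ by ext v; rfl
  exact norm_sub_le_of_norm_le_fderiv (J := J') (fun x ↦ (hJ' x).symm ▸ hderiv x)
    (by simpa only [hJ'] using hcont) hR.le hbound'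
end

section
/- Let n ≥ 1, let A be an n×n complex matrix, and let α, β > 0 be real. Consider the 2n×2n block matrix M = [[−A − βI_n, βI_n], [αI_n, −αI_n]]. Then λ ∈ ℂ is an eigenvalue of M if and only if there exists an eigenvalue ρ ∈ ℂ of A such that λ² + (α + β + ρ)λ + αρ = 0; equivalently, the eigenvalues of M are exactly the numbers λ = (−(α + β + ρ) ± √((α + β + ρ)² − 4αρ))/2 as ρ ranges over the eigenvalues of A. -/
/-- Lemma: eigenvalue relation: `λ` is an eigenvalue of the
Heavy Anchor system matrix `M = [[-A - βI, βI], [αI, -αI]]` if and only if there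
is an eigenvalue `ρ` of `A` with `λ² + (α + β + ρ)λ + αρ = 0`. -/
theorem heavy_anchor_eigenvalue_relation (n : ℕ) (hn : 1 ≤ n)
    (A : Matrix (Fin n) (Fin n) ℂ) (α β : ℝ) (hα : 0 < α) (hβ : 0 < β) :
    ∀ lam : ℂ,
      (∃ v : (Fin n ⊕ Fin n) → ℂ, v ≠ 0 ∧
          (Matrix.fromBlocks (-A - (β : ℂ) • 1) ((β : ℂ) • 1)
              ((α : ℂ) • 1) (-(α : ℂ) • 1)).mulVec v = lam • v)
        ↔ ∃ ρ : ℂ, (∃ w : Fin n → ℂ, w ≠ 0 ∧ A.mulVec w = ρ • w)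
            ∧ lam ^ 2 + ((α : ℂ) + β + ρ) * lam + (α : ℂ) * ρ = 0 := by
  have hα' : (α : ℂ) ≠ 0 := by exact_mod_cast hα.ne'
  have hβ' : (β : ℂ) ≠ 0 := by exact_mod_cast hβ.ne'
  intro lam
  constructor
  · rintro ⟨v, hv, h⟩
    obtain ⟨x, r, rfl⟩ : ∃ x r : Fin n → ℂ, v = Sum.elim x r :=
      ⟨v ∘ Sum.inl, v ∘ Sum.inr, (Sum.elim_comp_inl_inr v).symm⟩
    have h_top (i : Fin n) : -(A.mulVec x i) - β * x i + β * r i = lam * x i := by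
      simpa [Matrix.fromBlocks_mulVec, Matrix.sub_mulVec, Matrix.neg_mulVec, Matrix.smul_mulVec]
        using congrFun h (Sum.inl i)
    have h_bot (i : Fin n) : α * x i + -(α * r i) = lam * r i := by
      simpa [Matrix.fromBlocks_mulVec, Matrix.neg_mulVec, Matrix.smul_mulVec]
        using congrFun h (Sum.inr i)
    have h_lam : lam + α ≠ 0 := by
      intro h_zero
      have hx (i : Fin n) : x i = 0 :=
        mul_left_cancel₀ hα' (by linear_combination h_bot i + r i * h_zero)
      have hr (i : Fin n) : r i = 0 := by
        have hAx : A.mulVec x i = 0 := by simp [funext hx, ← Pi.zero_def]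
        exact mul_left_cancel₀ hβ'
          (by linear_combination h_top i + hAx + (β + lam) * hx i)
      exact hv (funext fun i => by cases i <;> simp [hx, hr])
    refine ⟨α * β / (lam + α) - (lam + β), ⟨x, ?_, ?_⟩, ?_⟩
    · rintro rfl
      have hr (i : Fin n) : r i = 0 := by
        have h_bot_i := h_bot i
        simp only [Pi.zero_apply] at h_bot_i
        exact mul_left_cancel₀ h_lam (by linear_combination -h_bot_i)
      exact hv (funext fun i => by cases i <;> simp [hr])
    · ext i
      simp only [Pi.smul_apply, smul_eq_mul]
      field_simp
      linear_combination -(lam + α) * h_top i - β * h_bot i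
    · field_simp
      ring
  · rintro ⟨ρ, ⟨w, hw, hAw⟩, hρ⟩
    refine ⟨Sum.elim ((lam + α) • w) ((α : ℂ) • w), ?_, ?_⟩
    · intro h_zero
      refine hw (funext fun i => mul_left_cancel₀ hα' ?_)
      simpa using congrFun h_zero (Sum.inr i)
    · ext i
      cases i with
      | inl i =>
        simp [Matrix.fromBlocks_mulVec, Matrix.sub_mulVec, Matrix.neg_mulVec,
          Matrix.smul_mulVec, Matrix.mulVec_smul, hAw]
        linear_combination -(w i) * hρ
      | inr i =>
        simp [Matrix.fromBlocks_mulVec, Matrix.neg_mulVec, Matrix.smul_mulVec]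
        ring
end

section
/- Let α, β > 0 be real and let ρ = r + 𝔦k ∈ ℂ with r ≥ 0 and ρ ≠ 0. Then every complex root λ of the quadratic λ² + (α + β + ρ)λ + αρ = 0 has real part strictly less than 0. -/
/-- Lemma stableA (ii): if `ρ ≠ 0` has nonnegative real part and
`α, β > 0`, every root of `λ² + (α + β + ρ)λ + αρ = 0` has negative real part. -/
theorem quadratic_roots_stable_monotone (α β : ℝ) (hα : 0 < α) (hβ : 0 < β)
    (ρ : ℂ) (hρre : 0 ≤ ρ.re) (hρ : ρ ≠ 0) :
    ∀ lam : ℂ, lam ^ 2 + ((α : ℂ) + β + ρ) * lam + (α : ℂ) * ρ = 0 →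
      lam.re < 0 := by
  intro lam h
  by_contra! hx
  have hre := congrArg Complex.re h
  have him := congrArg Complex.im h
  simp only [pow_two, Complex.add_re, Complex.add_im, Complex.mul_re, Complex.mul_im,
    Complex.ofReal_re, Complex.ofReal_im, Complex.zero_re, Complex.zero_im] at hre him
  -- The real part of the equation multiplied by the conjugate of `lam + α`.
  have key : (ρ.re + lam.re) * ((lam.re + α) ^ 2 + lam.im ^ 2) + β * (α * lam.re)
      + β * (lam.re ^ 2 + lam.im ^ 2) = 0 := by
    linear_combination (lam.re + α) * hre + lam.im * him
  have h₁ : 0 ≤ (ρ.re + lam.re) * ((lam.re + α) ^ 2 + lam.im ^ 2) := by positivity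
  have h₂ : 0 ≤ β * (α * lam.re) := by positivity
  have h₃ : lam.re ^ 2 + lam.im ^ 2 ≤ 0 := by
    by_contra! hpos
    linarith [mul_pos hβ hpos]
  have hlam : lam = 0 := by
    rw [← Complex.normSq_eq_zero]
    refine le_antisymm ?_ (Complex.normSq_nonneg lam)
    rw [Complex.normSq_apply]
    linarith
  subst hlam
  simp [hα.ne', hρ] at h
end

section
/- Let ρ = r + 𝔦k ∈ ℂ with r < 0, and let β, α be real parameters satisfying −r < β < (k² + r²)/(−r) and 0 < α < −(β + r) + √((β + r)k²/(−r)). Then every complex root λ of the quadratic λ² + (α + β + ρ)λ + αρ = 0 has real part strictly less than 0. -/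
/-- Lemma stableA (iii): if `ρ = r + 𝔦k` with `r < 0`,
`-r < β < (k² + r²)/(-r)` and `0 < α < -(β + r) + √((β + r)k²/(-r))`,
then every root of `λ² + (α + β + ρ)λ + αρ = 0` has negative real part. -/
theorem quadratic_roots_stable_hypomonotone (ρ : ℂ) (hr : ρ.re < 0)
    (α β : ℝ)
    (hβl : -ρ.re < β) (hβu : β < (ρ.im ^ 2 + ρ.re ^ 2) / (-ρ.re))
    (hαl : 0 < α)
    (hαu : α < -(β + ρ.re) + Real.sqrt ((β + ρ.re) * ρ.im ^ 2 / (-ρ.re))) :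
    ∀ lam : ℂ, lam ^ 2 + ((α : ℂ) + β + ρ) * lam + (α : ℂ) * ρ = 0 →
      lam.re < 0 := by
  intro lam h
  by_contra! hx
  obtain ⟨r, k⟩ := ρ
  obtain ⟨x, y⟩ := lam
  have hre := congrArg Complex.re h
  have him := congrArg Complex.im h
  simp only [pow_two, Complex.add_re, Complex.add_im, Complex.mul_re, Complex.mul_im,
    Complex.ofReal_re, Complex.ofReal_im, Complex.zero_re, Complex.zero_im] at hre him
  simp only at hr hβl hαu hx
  have hb : 0 < β + r := by linarith
  have ha : 0 < α + (β + r) := by linarith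
  have hsqrt : (α + (β + r)) ^ 2 < (β + r) * k ^ 2 / (-r) :=
    (Real.lt_sqrt ha.le).mp (by linarith)
  rw [lt_div_iff₀ (by linarith)] at hsqrt
  obtain ⟨b, rfl⟩ : ∃ b, β = b - r := ⟨β + r, by ring⟩
  rw [sub_add_cancel] at hb ha hsqrt
  have hk : 0 < 4 * α * r + k ^ 2 := by
    by_contra! hneg
    nlinarith [mul_nonneg hb.le (neg_nonneg.mpr hneg),
      mul_nonneg (neg_pos.mpr hr).le (sq_nonneg (α - b))]
  have hpos : 0 ≤ x * (x + (α + b)) * (4 * α * r + k ^ 2 + (2 * x + (α + b)) ^ 2) := by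
    positivity
  have hconst : 0 < α * (b * k ^ 2 - (α + b) ^ 2 * (-r)) :=
    mul_pos hαl (by linarith)
  have key : (x ^ 2 + (α + b) * x + α * r) * (2 * x + (α + b)) ^ 2
      + k ^ 2 * (x + α) * (x + b) = 0 := by
    linear_combination (2 * x + (α + b)) ^ 2 * hre +
      (y * (2 * x + (α + b)) - k * (x + α) + k * (2 * x + (α + b))) * him
  linarith
end

section
/- Let n ≥ 1, let A be a real n×n matrix, and let α, β > 0 be real. Suppose that for every eigenvalue ρ = r + 𝔦k of A (over ℂ) with r < 0 one has −r < β < (k² + r²)/(−r) and α < −(β + r) + √((β + r)k²/(−r)). Then every complex eigenvalue λ of the 2n×2n real matrix M = [[−A − βI_n, βI_n], [αI_n, −αI_n]] satisfies either Re λ < 0 or λ = 0, and λ = 0 occurs only if 0 is an eigenvalue of A. In particular, if A is invertible then M is Hurwitz (all eigenvalues have strictly negative real part). -/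
/-- A nonzero root of `z ^ 2 + (α + β + ρ) z + α ρ` with nonnegative real part
forces `ρ.re < 0`. -/
lemma re_neg_of_root_of_re_nonneg {α β : ℝ} (hα : 0 < α) (hβ : 0 < β) {z ρ : ℂ}
    (hroot : ρ * (z + α) = -(z * (z + α + β))) (hz : 0 ≤ z.re) (hz0 : z ≠ 0) : ρ.re < 0 := by
  obtain ⟨p, q⟩ := z
  obtain ⟨r, k⟩ := ρ
  simp only [Complex.ext_iff, Complex.mul_re, Complex.mul_im, Complex.add_re, Complex.add_im,
    Complex.neg_re, Complex.neg_im, Complex.ofReal_re, Complex.ofReal_im] at hroot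
  simp only at hz ⊢
  obtain ⟨h_re, h_im⟩ := hroot
  have hpq : 0 < p ^ 2 + q ^ 2 := by
    by_contra! h
    refine hz0 (Complex.ext ?_ ?_)
    · change p = 0
      nlinarith [sq_nonneg p, sq_nonneg q]
    · change q = 0
      nlinarith [sq_nonneg p, sq_nonneg q]
  have hD : 0 < (p + α) ^ 2 + q ^ 2 := by positivity
  have key : r * ((p + α) ^ 2 + q ^ 2)
      = -(p * ((p + α) ^ 2 + q ^ 2)) - β * (p ^ 2 + q ^ 2 + α * p) := by
    linear_combination (p + α) * h_re + q * h_im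
  have hneg : r * ((p + α) ^ 2 + q ^ 2) < 0 := by
    have h1 : 0 ≤ p * ((p + α) ^ 2 + q ^ 2) := by positivity
    have h2 : 0 < β * (p ^ 2 + q ^ 2 + α * p) := by positivity
    linarith
  exact neg_of_mul_neg_left hneg hD.le

/-- Positivity of the polynomial obtained by eliminating the imaginary part of a root. -/
lemma eliminant_pos {α m s K p : ℝ} (hα : 0 < α) (hm : 0 < m) (hs : 0 < s)
    (hK : (α + m) ^ 2 * s < m * K) (hp : 0 ≤ p) :
    0 < (p ^ 2 + (α + m) * p - α * s) * (2 * p + (α + m)) ^ 2 + K * (p + α) * (p + m) := by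
  have h4 : 4 * α * s < K := by
    have h : m * (4 * α * s) < m * K := by nlinarith [mul_nonneg hs.le (sq_nonneg (α - m))]
    exact lt_of_mul_lt_mul_left h hm.le
  have h1 : 0 < α * (m * K - (α + m) ^ 2 * s) := mul_pos hα (by linarith)
  have h2 : 0 ≤ (p ^ 2 + (α + m) * p) * ((2 * p + (α + m)) ^ 2 + (K - 4 * α * s)) := by
    have : 0 < K - 4 * α * s := by linarith
    positivity
  nlinarith

/-- Under the Heavy Anchor conditions every root of `z ^ 2 + (α + β + ρ) z + α ρ` has negative
real part. -/
lemma re_neg_of_root {α β : ℝ} (hα : 0 < α) {z ρ : ℂ}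
    (hroot : ρ * (z + α) = -(z * (z + α + β))) (hρ : ρ.re < 0) (hβρ : -ρ.re < β)
    (hαρ : α < -(β + ρ.re) + √((β + ρ.re) * ρ.im ^ 2 / (-ρ.re))) : z.re < 0 := by
  by_contra! hz
  obtain ⟨p, q⟩ := z
  obtain ⟨r, k⟩ := ρ
  simp only [Complex.ext_iff, Complex.mul_re, Complex.mul_im, Complex.add_re, Complex.add_im,
    Complex.neg_re, Complex.neg_im, Complex.ofReal_re, Complex.ofReal_im] at hroot
  simp only at hz hρ hβρ hαρ
  obtain ⟨h_re, h_im⟩ := hroot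
  have hs : 0 < -r := by linarith
  have hm : 0 < β + r := by linarith
  have hK : (α + (β + r)) ^ 2 * (-r) < (β + r) * k ^ 2 := by
    rw [← lt_div_iff₀ hs]
    exact (Real.lt_sqrt (by linarith)).1 (by linarith)
  have hpos := eliminant_pos hα hm hs hK hz
  have hq : q * (2 * p + (α + (β + r))) = -(k * (p + α)) := by linear_combination h_im
  refine hpos.ne' ?_
  linear_combination (2 * p + (α + (β + r))) ^ 2 * h_re
    + (q * (2 * p + (α + (β + r))) + k * (p + β + r)) * hq

/-- An eigenvector of the Heavy Anchor matrix for an eigenvalue `z ≠ -α` gives an eigenvector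
of `A` whose eigenvalue `ρ` satisfies `ρ (z + α) = -z (z + α + β)`. -/
lemma exists_eigenvector_of_heavyAnchor_eigenvector {n : ℕ} {A : Matrix (Fin n) (Fin n) ℝ}
    {α β : ℝ} {z : ℂ} (hz : z + α ≠ 0) {v : Fin n ⊕ Fin n → ℂ} (hv : v ≠ 0)
    (h : ((Matrix.fromBlocks (-A - β • 1) (β • 1) (α • 1) (-α • 1)).map
      (Complex.ofReal ·)).mulVec v = z • v) :
    ∃ ρ : ℂ, ρ * (z + α) = -(z * (z + α + β)) ∧
      ∃ w : Fin n → ℂ, w ≠ 0 ∧ (A.map (Complex.ofReal ·)).mulVec w = ρ • w := by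
  have h_top (i : Fin n) : -(A.map (Complex.ofReal ·)).mulVec (v ∘ Sum.inl) i
      - β * v (.inl i) + β * v (.inr i) = z * v (.inl i) := by
    have := congrFun h (.inl i)
    simpa [Matrix.mulVec, dotProduct, Matrix.one_apply, sub_mul, Finset.sum_sub_distrib,
      apply_ite Complex.ofReal] using this
  have h_bot (i : Fin n) : α * v (.inl i) - α * v (.inr i) = z * v (.inr i) := by
    have := congrFun h (.inr i)
    simpa [Matrix.mulVec, dotProduct, Matrix.one_apply, apply_ite Complex.ofReal,
      ← sub_eq_add_neg] using this
  refine ⟨-(z * (z + α + β)) / (z + α), div_mul_cancel₀ _ hz, v ∘ Sum.inl, ?_, ?_⟩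
  · intro hw
    have hl (i : Fin n) : v (.inl i) = 0 := congrFun hw i
    refine hv (funext ?_)
    rintro (i | i)
    · exact hl i
    · have : (z + α) * v (.inr i) = 0 := by
        linear_combination α * hl i - h_bot i
      exact (mul_eq_zero.1 this).resolve_left hz
  · ext i
    simp only [Pi.smul_apply, smul_eq_mul, Function.comp_apply]
    rw [div_mul_eq_mul_div, eq_div_iff hz]
    linear_combination -(z + α) * h_top i - β * h_bot i


/-- Theorem fullQuad, eigenvalue form: if for every eigenvalue
`ρ = r + 𝔦k` of `A` with `r < 0` the parameters satisfy
`-r < β < (k² + r²)/(-r)` and `α < -(β + r) + √((β + r)k²/(-r))`, then every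
eigenvalue `λ` of `M = [[-A - βI, βI], [αI, -αI]]` satisfies `Re λ < 0` or
`λ = 0`, the latter only if `0` is an eigenvalue of `A`; in particular if `A`
is invertible then `M` is Hurwitz. -/
theorem heavy_anchor_quadratic_hurwitz (n : ℕ) (hn : 1 ≤ n)
    (A : Matrix (Fin n) (Fin n) ℝ) (α β : ℝ) (hα : 0 < α) (hβ : 0 < β)
    (hcond : ∀ ρ : ℂ,
      (∃ w : Fin n → ℂ, w ≠ 0 ∧ (A.map (Complex.ofReal ·)).mulVec w = ρ • w) →
      ρ.re < 0 →
        -ρ.re < β ∧ β < (ρ.im ^ 2 + ρ.re ^ 2) / (-ρ.re) ∧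
          α < -(β + ρ.re) + Real.sqrt ((β + ρ.re) * ρ.im ^ 2 / (-ρ.re))) :
    (∀ lam : ℂ,
      (∃ v : (Fin n ⊕ Fin n) → ℂ, v ≠ 0 ∧
          ((Matrix.fromBlocks (-A - β • 1) (β • 1) (α • 1) (-α • 1)).map
              (Complex.ofReal ·)).mulVec v = lam • v) →
        (lam.re < 0 ∨ lam = 0) ∧
          (lam = 0 →
            ∃ w : Fin n → ℂ, w ≠ 0 ∧ (A.map (Complex.ofReal ·)).mulVec w = 0))
    ∧ (IsUnit A.det →
        ∀ lam : ℂ,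
          (∃ v : (Fin n ⊕ Fin n) → ℂ, v ≠ 0 ∧
              ((Matrix.fromBlocks (-A - β • 1) (β • 1) (α • 1) (-α • 1)).map
                  (Complex.ofReal ·)).mulVec v = lam • v) →
          lam.re < 0) := by
  have main : ∀ lam : ℂ,
      (∃ v : (Fin n ⊕ Fin n) → ℂ, v ≠ 0 ∧
          ((Matrix.fromBlocks (-A - β • 1) (β • 1) (α • 1) (-α • 1)).map
              (Complex.ofReal ·)).mulVec v = lam • v) →
        (lam.re < 0 ∨ lam = 0) ∧
          (lam = 0 →
            ∃ w : Fin n → ℂ, w ≠ 0 ∧ (A.map (Complex.ofReal ·)).mulVec w = 0) := by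
    rintro lam ⟨v, hv, h⟩
    by_cases hlam : lam + α = 0
    · have hre : lam.re < 0 := by
        have := congrArg Complex.re hlam
        simp only [Complex.add_re, Complex.ofReal_re, Complex.zero_re] at this
        linarith
      exact ⟨.inl hre, fun h0 => by simp [h0] at hre⟩
    obtain ⟨ρ, hroot, w, hw, hAw⟩ := exists_eigenvector_of_heavyAnchor_eigenvector hlam hv h
    constructor
    · by_contra! hcon
      have hρ := re_neg_of_root_of_re_nonneg hα hβ hroot hcon.1 hcon.2
      obtain ⟨h1, -, h3⟩ := hcond ρ ⟨w, hw, hAw⟩ hρ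
      exact hcon.1.not_gt (re_neg_of_root hα hroot hρ h1 h3)
    · rintro rfl
      have hρ : ρ = 0 := by
        rw [zero_mul, neg_zero] at hroot
        exact (mul_eq_zero.1 hroot).resolve_right hlam
      exact ⟨w, hw, by rw [hAw, hρ, zero_smul]⟩
  refine ⟨main, fun hA lam hlam => ?_⟩
  obtain ⟨h1, h2⟩ := main lam hlam
  refine h1.resolve_right fun h0 => ?_
  obtain ⟨w, hw, hAw⟩ := h2 h0
  refine hw (Matrix.eq_zero_of_mulVec_eq_zero ?_ hAw)
  have hdet : (A.map (Complex.ofReal ·)).det = (A.det : ℂ) :=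
    (RingHom.map_det Complex.ofRealHom A).symm
  rw [hdet]
  exact_mod_cast hA.ne_zero
end
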